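/- arXiv:2503.01825 — 2 statements merged into one kernel-verified Lean document; each statement's English description precedes it below -/
import Mathlib

section
/- Let 0 < ε ≤ 1 and let G be a properly edge-coloured digraph with minimum in-degree δ⁻(G) ≥ 9ε⁻³. Then G contains a rainbow directed path forest with at most 9ε⁻² components and at least (1−ε)·δ⁻(G) edges. -/
/-- A proper edge-colouring of a digraph: no two edges with a common start-vertex and
no two edges with a common end-vertex share a colour. -/
def ProperDiColoring {V C : Type*} (E : V → V → Prop) (c : V → V → C) : Prop :=
  (∀ u v w, E u v → E u w → c u v = c u w → v = w) ∧
  (∀ u v w, E u v → E w v → c u v = c w v → u = w)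

/-- A rainbow directed path forest with `t` components: `t` vertex-disjoint directed
paths (the `j`-th of length `ℓ j`), all of whose edges have pairwise distinct
colours. -/
def IsRainbowDiPathForest {V C : Type*} (E : V → V → Prop) (c : V → V → C) {t : ℕ}
    (ℓ : Fin t → ℕ) (p : ∀ j, Fin (ℓ j + 1) → V) : Prop :=
  (∀ (j) (i : Fin (ℓ j)), E (p j i.castSucc) (p j i.succ)) ∧
  Function.Injective (fun q : Σ j, Fin (ℓ j + 1) => p q.1 q.2) ∧
  Function.Injective (fun q : Σ j, Fin (ℓ j) => c (p q.1 q.2.castSucc) (p q.1 q.2.succ))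

def PFed {V : Type*} (l : List V) : List (V × V) := l.zip l.tail

def PFedges {V : Type*} (L : List (List V)) : List (V × V) := L.flatMap PFed

def PFheads {V : Type*} (L : List (List V)) : List V := L.filterMap List.head?

section PF
variable {V : Type*}

lemma PFed_cons2 (a b : V) (l : List V) : PFed (a :: b :: l) = (a, b) :: PFed (b :: l) := rfl

lemma PFed_single (a : V) : PFed [a] = [] := rfl

lemma PFed_append (a : List V) (w : V) (b : List V) :
    PFed (a ++ w :: b) = PFed (a ++ [w]) ++ PFed (w :: b) := by
  induction a with
  | nil => simp [PFed_single]
  | cons x a ih =>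
    cases a with
    | nil => simp [PFed_cons2, PFed_single]
    | cons y a => 
      simp only [List.cons_append, PFed_cons2] at ih ⊢
      rw [ih]

lemma PFed_length (l : List V) (h : l ≠ []) : (PFed l).length + 1 = l.length := by
  cases l with
  | nil => exact absurd rfl h
  | cons x l => simp [PFed]

lemma PFed_mem {w w' : V} {l : List V} (h : (w, w') ∈ PFed l) : ∃ a b, l = a ++ w :: w' :: b := by
  induction l with
  | nil => simp [PFed] at h
  | cons x l ih =>
    cases l with
    | nil => simp [PFed] at h
    | cons y l =>
      rw [PFed_cons2, List.mem_cons] at h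
      rcases h with h | h
      · cases h; exact ⟨[], l, rfl⟩
      · obtain ⟨a, b, hab⟩ := ih h
        exact ⟨x :: a, b, by rw [hab]; rfl⟩

lemma PFed_tail_or_last {w : V} {l : List V} (h : w ∈ l) :
    (∃ a, l = a ++ [w]) ∨ ∃ w', (w, w') ∈ PFed l := by
  obtain ⟨a, b, rfl⟩ := List.append_of_mem h
  cases b with
  | nil => exact Or.inl ⟨a, rfl⟩
  | cons y b =>
    right
    refine ⟨y, ?_⟩
    rw [PFed_append, PFed_cons2]
    simp

lemma PFedges_cons (l : List V) (L : List (List V)) : PFedges (l :: L) = PFed l ++ PFedges L := by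
  simp [PFedges]

lemma PFedges_perm {L L' : List (List V)} (h : L.Perm L') : (PFedges L).Perm (PFedges L') :=
  h.flatMap_right _

lemma PFheads_perm {L L' : List (List V)} (h : L.Perm L') : (PFheads L).Perm (PFheads L') :=
  h.filterMap _

lemma PFheads_cons (a : V) (l : List V) (L : List (List V)) :
    PFheads ((a :: l) :: L) = a :: PFheads L := by
  simp [PFheads]

lemma PFheads_app (a : List V) (w : V) (b : List V) (L : List (List V)) :
    PFheads ((a ++ w :: b) :: L) = (a ++ [w]).head (by simp) :: PFheads L := by
  cases a <;> simp [PFheads]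

lemma PFheads_mem {s : V} {L : List (List V)} : s ∈ PFheads L ↔ ∃ b, (s :: b) ∈ L := by
  simp only [PFheads, List.mem_filterMap]
  constructor
  · rintro ⟨a, ha, h⟩
    cases a with
    | nil => simp at h
    | cons x a => simp at h; subst h; exact ⟨a, ha⟩
  · rintro ⟨b, hb⟩; exact ⟨_, hb, rfl⟩

lemma PFcount (L : List (List V)) (h : ∀ l ∈ L, l ≠ []) :
    (PFedges L).length + L.length = L.flatten.length := by
  induction L with
  | nil => rfl
  | cons l L ih =>
    rw [PFedges_cons]
    have := PFed_length l (h l (by simp))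
    have := ih (fun l hl => h l (by simp [hl]))
    simp only [List.length_append, List.length_cons, List.flatten_cons]
    omega

lemma PFheads_length (L : List (List V)) (h : ∀ l ∈ L, l ≠ []) :
    (PFheads L).length = L.length := by
  induction L with
  | nil => rfl
  | cons l L ih =>
    have h1 := ih (fun l hl => h l (by simp [hl]))
    cases l with
    | nil => exact absurd rfl (h [] (by simp))
    | cons x l => rw [PFheads_cons]; simp [h1]

lemma PFheads_sublist (L : List (List V)) : (PFheads L).Sublist L.flatten := by
  induction L with
  | nil => simp [PFheads]
  | cons l L ih =>
    cases l with
    | nil => exact ih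
    | cons x l =>
      rw [PFheads_cons]
      simp only [List.flatten_cons, List.cons_append]
      exact (ih.trans (List.sublist_append_right _ _)).cons_cons x

lemma PFfst_sublist (L : List (List V)) : ((PFedges L).map Prod.fst).Sublist L.flatten := by
  induction L with
  | nil => simp [PFedges]
  | cons l L ih =>
    rw [PFedges_cons, List.map_append, List.flatten_cons]
    refine List.Sublist.append ?_ ih
    clear ih
    induction l with
    | nil => simp [PFed]
    | cons x l ih2 =>
      cases l with
      | nil => simp [PFed]
      | cons y l =>
        rw [PFed_cons2, List.map_cons]
        exact ih2.cons_cons x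

lemma PFswap (L : List (List V)) (hne : ∀ l ∈ L, l ≠ []) (hnd : L.flatten.Nodup) (w w' : V)
    (h : (w, w') ∈ PFedges L) :
    ∃ h0, ∀ s, s ∈ PFheads L → s ≠ h0 → ∃ L' : List (List V), L'.length = L.length ∧
      (∀ l ∈ L', l ≠ []) ∧ L'.flatten.Perm L.flatten ∧
      ((w, w') :: PFedges L').Perm ((w, s) :: PFedges L) ∧
      (s :: PFheads L').Perm (w' :: PFheads L) := by
  obtain ⟨l, hl, hwl⟩ := List.mem_flatMap.1 h
  obtain ⟨a, b, rfl⟩ := PFed_mem hwl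
  obtain ⟨L1, hL1⟩ : ∃ L1, L.Perm ((a ++ w :: w' :: b) :: L1) := by
    classical exact ⟨_, List.perm_cons_erase hl⟩
  refine ⟨(a ++ [w]).head (by simp), fun s hs hs0 => ?_⟩
  have hs1 : s ∈ PFheads L1 := by
    have := (PFheads_perm hL1).mem_iff.1 hs
    rw [PFheads_app] at this
    simpa [hs0] using this
  obtain ⟨b', hb'⟩ := PFheads_mem.1 hs1
  obtain ⟨L2, hL2⟩ : ∃ L2, L1.Perm ((s :: b') :: L2) := by
    classical exact ⟨_, List.perm_cons_erase hb'⟩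
  have hL : L.Perm ((a ++ w :: w' :: b) :: (s :: b') :: L2) := hL1.trans (hL2.cons _)
  refine ⟨(a ++ w :: s :: b') :: (w' :: b) :: L2, ?_, ?_, ?_, ?_, ?_⟩
  · simp [hL.length_eq]
  · intro l hl
    simp only [List.mem_cons] at hl
    rcases hl with rfl | rfl | hl
    · simp
    · simp
    · exact hne l (hL.mem_iff.2 (by simp [hl]))
  · refine List.Perm.trans ?_ hL.flatten.symm
    classical
    rw [List.perm_iff_count]
    intro x
    simp only [List.flatten_cons, List.count_append, List.count_cons]
    omega
  · refine List.Perm.trans ?_ ((PFedges_perm hL).symm.cons _)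
    classical
    rw [List.perm_iff_count]
    intro x
    simp only [PFedges_cons, PFed_append a w (w' :: b), PFed_append a w (s :: b'), PFed_cons2, List.count_append, List.count_cons]
    omega
  · refine List.Perm.trans ?_ ((PFheads_perm hL).symm.cons _)
    classical
    rw [List.perm_iff_count]
    intro x
    simp only [PFheads_app, PFheads_cons, List.count_cons]
    omega

lemma PFjoin (L : List (List V)) (hne : ∀ l ∈ L, l ≠ []) (hnd : L.flatten.Nodup) (s : V)
    (hs : s ∈ PFheads L) :
    ∃ z, ∀ w, w ≠ z → (∀ w', (w, w') ∉ PFedges L) → ∃ L' : List (List V), L'.length ≤ L.length ∧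
      (∀ l ∈ L', l ≠ []) ∧ L'.flatten.Nodup ∧
      (PFedges L').Perm ((w, s) :: PFedges L) ∧
      (∀ h ∈ PFheads L, h ≠ s → h ∈ PFheads L') := by
  obtain ⟨b, hb⟩ := PFheads_mem.1 hs
  obtain ⟨L1, hL1⟩ : ∃ L1, L.Perm ((s :: b) :: L1) := by
    classical exact ⟨_, List.perm_cons_erase hb⟩
  refine ⟨(s :: b).getLast (by simp), fun w hwz hw => ?_⟩
  have hnd1 : ((s :: b) :: L1).flatten.Nodup := hL1.flatten.nodup_iff.1 hnd
  by_cases hwL : w ∈ L.flatten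
  · obtain ⟨l, hl, hwl⟩ := List.mem_flatten.1 hwL
    rcases PFed_tail_or_last hwl with ⟨a, rfl⟩ | ⟨w', hw'⟩
    swap
    · exact absurd (List.mem_flatMap.2 ⟨l, hl, hw'⟩) (hw w')
    have hl1 : (a ++ [w]) ∈ L1 := by
      have := hL1.mem_iff.1 hl
      rw [List.mem_cons] at this
      rcases this with h | h
      · exfalso; apply hwz
        simp [← h]
      · exact h
    obtain ⟨L2, hL2⟩ : ∃ L2, L1.Perm ((a ++ [w]) :: L2) := by
      classical exact ⟨_, List.perm_cons_erase hl1⟩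
    have hL : L.Perm ((s :: b) :: (a ++ [w]) :: L2) := hL1.trans (hL2.cons _)
    refine ⟨(a ++ w :: s :: b) :: L2, ?_, ?_, ?_, ?_, ?_⟩
    · simp [hL.length_eq]
    · intro l hl
      simp only [List.mem_cons] at hl
      rcases hl with rfl | hl
      · simp
      · exact hne l (hL.mem_iff.2 (by simp [hl]))
    · refine (List.Perm.nodup_iff ?_).1 hnd
      refine hL.flatten.trans ?_
      classical
      rw [List.perm_iff_count]
      intro x
      simp only [List.flatten_cons, List.count_append, List.count_cons, List.count_nil]
      omega
    · refine List.Perm.trans ?_ ((PFedges_perm hL).symm.cons _)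
      classical
      rw [List.perm_iff_count]
      intro x
      simp only [PFedges_cons, PFed_append a w (s :: b), PFed_cons2, List.count_append, List.count_cons]
      omega
    · intro h hh hhs
      have := (PFheads_perm hL).mem_iff.1 hh
      rw [PFheads_cons, PFheads_app] at this
      rw [PFheads_app]
      simpa [hhs] using this
  · refine ⟨(w :: s :: b) :: L1, ?_, ?_, ?_, ?_, ?_⟩
    · simp [hL1.length_eq]
    · intro l hl
      simp only [List.mem_cons] at hl
      rcases hl with rfl | hl
      · simp
      · exact hne l (hL1.mem_iff.2 (by simp [hl]))
    · have : w ∉ ((s :: b) :: L1).flatten := fun h => hwL (hL1.flatten.mem_iff.2 h)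
      simp only [List.flatten_cons, List.cons_append] at this hnd1 ⊢
      exact List.nodup_cons.2 ⟨this, hnd1⟩
    · refine List.Perm.trans ?_ ((PFedges_perm hL1).symm.cons _)
      rw [PFedges_cons, PFedges_cons, PFed_cons2]
      simp
    · intro h hh hhs
      have := (PFheads_perm hL1).mem_iff.1 hh
      rw [PFheads_cons] at this ⊢
      simp [hhs] at this
      simp [this]

lemma PFflat_inj {α : Type*} (L : List (List α)) (h : L.flatten.Nodup) :
    ∀ (j j' : ℕ) (hj : j < L.length) (hj' : j' < L.length) (i i' : ℕ) (hi : i < L[j].length)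
      (hi' : i' < L[j'].length), L[j][i] = L[j'][i'] → j = j' ∧ i = i' := by
  intro j j' hj hj' i i' hi hi' he
  rw [List.nodup_flatten] at h
  have hjj : j = j' := by
    by_contra hne
    have h2 := List.pairwise_iff_getElem.1 h.2
    rcases lt_or_gt_of_ne hne with hlt | hlt
    · exact (h2 j j' hj hj' hlt) (List.getElem_mem hi) (he ▸ List.getElem_mem hi')
    · exact (h2 j' j hj' hj hlt) (List.getElem_mem hi') (he ▸ List.getElem_mem hi)
  subst hjj
  exact ⟨rfl, (h.1 _ (List.getElem_mem hj)).getElem_inj_iff.1 he⟩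

lemma PFconvert {C : Type*} (E : V → V → Prop) (c : V → V → C) (L : List (List V))
    (hne : ∀ l ∈ L, l ≠ []) (hnd : L.flatten.Nodup) (hE : ∀ e ∈ PFedges L, E e.1 e.2)
    (hc : ((PFedges L).map (fun e => c e.1 e.2)).Nodup) :
    ∃ (ℓ : Fin L.length → ℕ) (p : ∀ j, Fin (ℓ j + 1) → V),
      IsRainbowDiPathForest E c ℓ p ∧ ∑ j, ℓ j = (PFedges L).length := by
  have hlen : ∀ j : Fin L.length, (L[j].length - 1) + 1 = L[j].length := fun j => by
    have := List.length_pos_iff.2 (hne L[j] (List.getElem_mem j.2))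
    omega
  have hedlen : ∀ j : Fin L.length, (PFed L[j]).length = L[j].length - 1 := fun j => by
    have := PFed_length L[j] (hne L[j] (List.getElem_mem j.2))
    omega
  refine ⟨fun j => L[j].length - 1, fun j i => L[j][i.val]'(by have := hlen j; have h : i.val < L[j].length - 1 + 1 := i.2; omega), 
    ⟨?_, ?_, ?_⟩, ?_⟩
  · intro j i
    have hi : i.val < (PFed L[j]).length := by rw [hedlen]; exact i.2
    have := hE ((PFed L[j])[i.val]) (List.mem_flatMap.2 ⟨L[j], List.getElem_mem j.2, List.getElem_mem hi⟩)
    simpa [PFed] using this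
  · rintro ⟨j, i⟩ ⟨j', i'⟩ h
    simp only at h
    obtain ⟨h1, h2⟩ := PFflat_inj L hnd j j' j.2 j'.2 i i' (by have := hlen j; have := i.2; simp at *; omega)
      (by have := hlen j'; have := i'.2; simp at *; omega) h
    have h1 : j = j' := Fin.ext h1
    subst h1
    have h2 : i = i' := Fin.ext h2
    rw [h2]
  · rintro ⟨j, i⟩ ⟨j', i'⟩ h
    simp only at h
    have hi : i.val < (PFed L[j]).length := by rw [hedlen]; exact i.2
    have hi' : i'.val < (PFed L[j']).length := by rw [hedlen]; exact i'.2
    have hnd2 : (L.map (fun l => (PFed l).map (fun e => c e.1 e.2))).flatten.Nodup := by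
      rw [PFedges, List.map_flatMap] at hc
      exact hc
    obtain ⟨h1, h2⟩ := PFflat_inj _ hnd2 j j' (by simp) (by simp) i i' (by simpa using hi)
      (by simpa using hi') (by simpa [PFed] using h)
    have h1 : j = j' := Fin.ext h1
    subst h1
    have h2 : i = i' := Fin.ext h2
    rw [h2]
  · simp only [← hedlen]
    rw [PFedges, List.length_flatMap, ← List.sum_ofFn]
    congr 1
    apply List.ext_getElem
    · simp
    · intros; simp
end PF

def PFcol {V C : Type*} (c : V → V → C) (L : List (List V)) : List C :=
  (PFedges L).map (fun e => c e.1 e.2)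

structure PFok {V : Type*} (E : V → V → Prop) (L : List (List V)) : Prop where
  ne : ∀ l ∈ L, l ≠ []
  nd : L.flatten.Nodup
  he : ∀ e ∈ PFedges L, E e.1 e.2

def PFgood {V C : Type*} (c : V → V → C) (L : List (List V)) (A : Finset (V × V)) (γ : C) : Prop :=
  γ ∉ PFcol c L ∨ ∃ e ∈ A, γ = c e.1 e.2

open Classical in
noncomputable def PFA {V C : Type*} (E : V → V → Prop) (c : V → V → C) (L : List (List V))
    (r : ℕ) : ℕ → Finset (V × V)
  | 0 => ∅
  | j + 1 => PFA E c L r j ∪ (PFedges L).toFinset.filter (fun e =>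
      r ≤ ((PFheads L).toFinset.filter
        (fun s => E e.1 s ∧ PFgood c L (PFA E c L r j) (c e.1 s))).card)

section PF2
variable {V C : Type*}

lemma PFA_sub (E : V → V → Prop) (c : V → V → C) (L : List (List V)) (r j : ℕ) :
    ∀ e ∈ PFA E c L r j, e ∈ PFedges L := by
  classical
  induction j with
  | zero => simp [PFA]
  | succ j ih =>
    intro e he
    rw [PFA, Finset.mem_union] at he
    rcases he with he | he
    · exact ih e he
    · simpa using (Finset.mem_filter.1 he).1

lemma PFcol_length (c : V → V → C) (L : List (List V)) :
    (PFcol c L).length = (PFedges L).length := by simp [PFcol]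

lemma PFchain (E : V → V → Prop) (c : V → V → C) (L0 : List (List V)) (k r : ℕ)
    (hc0 : (PFcol c L0).Nodup)
    (hmax : ∀ L, PFok E L → L.length ≤ k → (PFcol c L).Nodup →
      (PFedges L).length ≤ (PFedges L0).length) :
    ∀ (j : ℕ) (L : List (List V)) (R : Finset V) (e : V × V), PFok E L → L.length ≤ k →
      R.card + j + 1 ≤ r → (∀ s ∈ PFheads L0, s ∉ R → s ∈ PFheads L) →
      (PFcol c L).Perm (c e.1 e.2 :: PFcol c L0) → e ∈ PFA E c L0 r j →
      (∀ e' ∈ PFA E c L0 r j, e' ∈ PFedges L) → False := by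
  classical
  intro j
  induction j with
  | zero => 
    intro L R e _ _ _ _ _ he
    simp [PFA] at he
  | succ j ih =>
    intro L R e hok hlen hr hh hcol he hA
    by_cases hej : e ∈ PFA E c L0 r j
    · exact ih L R e hok hlen (by omega) hh hcol hej
        (fun e' he' => hA e' (by rw [PFA]; exact Finset.mem_union_left _ he'))
    have he2 := he
    rw [PFA, Finset.mem_union] at he2
    have he3 := (Finset.mem_filter.1 (he2.resolve_left hej)).2
    obtain ⟨h0, hsw⟩ := PFswap L hok.ne hok.nd e.1 e.2 (hA e he)
    obtain ⟨s, hs, hsR⟩ : ∃ s ∈ (PFheads L0).toFinset.filter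
        (fun s => E e.1 s ∧ PFgood c L0 (PFA E c L0 r j) (c e.1 s)), s ∉ insert h0 R := by
      apply Finset.exists_mem_notMem_of_card_lt_card
      have := Finset.card_insert_le h0 R
      omega
    rw [Finset.mem_filter, List.mem_toFinset] at hs
    obtain ⟨hsT, hsE, hsg⟩ := hs
    rw [Finset.mem_insert, not_or] at hsR
    obtain ⟨L', hl', hne', hfl', hed', hhd'⟩ := hsw s (hh s hsT hsR.2) hsR.1
    have hmem : ∀ e' ∈ PFedges L, e' ≠ e → e' ∈ PFedges L' := by
      intro e' he' hne
      have := hed'.symm.subset (List.mem_cons_of_mem _ he')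
      rcases List.mem_cons.1 this with h | h
      · exact absurd h hne
      · exact h
    have hok' : PFok E L' := by
      refine ⟨hne', hfl'.nodup_iff.2 hok.nd, fun e' he' => ?_⟩
      have := hed'.subset (List.mem_cons_of_mem _ he')
      rcases List.mem_cons.1 this with h | h
      · rw [h]; exact hsE
      · exact hok.he _ h
    have hcol' : (PFcol c L').Perm (c e.1 s :: PFcol c L0) := by
      have h1 := hed'.map (fun e => c e.1 e.2)
      simp only [List.map_cons] at h1
      have h2 : (c e.1 e.2 :: PFcol c L').Perm (c e.1 s :: c e.1 e.2 :: PFcol c L0) :=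
        h1.trans (hcol.cons _)
      exact (h2.trans (List.Perm.swap _ _ _)).cons_inv
    rcases hsg with hg | ⟨e', he', hce'⟩
    · have := hmax L' hok' (by omega) (hcol'.nodup_iff.2 (List.nodup_cons.2 ⟨hg, hc0⟩))
      have h3 := hcol'.length_eq
      rw [List.length_cons, PFcol_length, PFcol_length] at h3
      omega
    · refine ih L' (insert s R) e' hok' (by omega) ?_ ?_ (hce' ▸ hcol') he' ?_
      · have := Finset.card_insert_le s R
        omega
      · intro h hh0 hhR
        rw [Finset.mem_insert, not_or] at hhR
        have := hhd'.symm.subset (List.mem_cons_of_mem _ (hh h hh0 hhR.2))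
        exact (List.mem_cons.1 this).resolve_left hhR.1
      · intro e'' he''
        refine hmem e'' (hA e'' (by rw [PFA]; exact Finset.mem_union_left _ he'')) ?_
        rintro rfl
        exact hej he''

lemma PFgrow [Fintype V] (E : V → V → Prop) (c : V → V → C) (hproper : ProperDiColoring E c)
    (L0 : List (List V)) (k r δ j : ℕ) (hδ : ∀ v : V, δ ≤ {w | E w v}.ncard)
    (hok : PFok E L0) (hk : L0.length = k) (hj : j + 2 ≤ r)
    (hc0 : (PFcol c L0).Nodup)
    (hmax : ∀ L, PFok E L → L.length ≤ k → (PFcol c L).Nodup →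
      (PFedges L).length ≤ (PFedges L0).length) :
    k * (δ + (PFA E c L0 r j).card) ≤ k * (PFA E c L0 r (j+1)).card +
      (r - 1) * (PFedges L0).length + k + k * (PFedges L0).length := by
  classical
  set m := (PFedges L0).length with hm
  set A := PFA E c L0 r j with hA
  set A' := PFA E c L0 r (j+1) with hA'
  set T := (PFheads L0).toFinset with hT
  set S := (PFedges L0).toFinset with hS
  have hSnd : (PFedges L0).Nodup := List.Nodup.of_map _ hc0
  have hScard : S.card = m := List.toFinset_card_of_nodup hSnd
  have hTcard : T.card = k := by
    rw [hT, List.toFinset_card_of_nodup ((PFheads_sublist L0).nodup hok.nd),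
      PFheads_length L0 hok.ne, hk]
  have hAS : A ⊆ S := fun e he => List.mem_toFinset.2 (PFA_sub E c L0 r j e he)
  have hA'S : A' ⊆ S := fun e he => List.mem_toFinset.2 (PFA_sub E c L0 r (j+1) e he)
  have hcinj : Set.InjOn (fun e : V × V => c e.1 e.2) (A : Set (V × V)) := by
    intro x hx y hy hxy
    exact List.inj_on_of_nodup_map hc0 (PFA_sub E c L0 r j x hx) (PFA_sub E c L0 r j y hy) hxy
  let P : V × V → V → Prop := fun e s => E e.1 s ∧ PFgood c L0 A (c e.1 s)
  have key : ∀ s ∈ T, δ + A.card ≤ (S.filter (fun e => P e s)).card + 1 + m := by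
    intro s hs
    have hs' : s ∈ PFheads L0 := List.mem_toFinset.1 hs
    set I : Finset V := Finset.univ.filter (fun w => E w s) with hI
    set N : Finset V := I.filter (fun w => PFgood c L0 A (c w s)) with hN
    have hIc : δ ≤ I.card := by
      have := hδ s
      rwa [Set.ncard_eq_toFinset_card', Set.toFinset_setOf] at this
    have hsplit : N.card + (I.filter (fun w => ¬ PFgood c L0 A (c w s))).card = I.card :=
      Finset.card_filter_add_card_filter_not _
    have hbad : (I.filter (fun w => ¬ PFgood c L0 A (c w s))).card + A.card ≤ m := by
      have h1 : (I.filter (fun w => ¬ PFgood c L0 A (c w s))).card ≤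
          ((PFcol c L0).toFinset \ A.image (fun e => c e.1 e.2)).card := by
        apply Finset.card_le_card_of_injOn (fun w => c w s)
        · intro w hw
          have hw2 := (Finset.mem_filter.1 hw).2
          simp only [PFgood, not_or, not_not] at hw2
          simp only [Finset.coe_sdiff, Set.mem_diff, Finset.mem_coe, List.mem_toFinset,
            Finset.mem_image]
          refine ⟨hw2.1, ?_⟩
          rintro ⟨e, he, hee⟩
          exact hw2.2 ⟨e, he, hee.symm⟩
        · intro w hw w' hw' hww
          have h1 := (Finset.mem_filter.1 (Finset.mem_filter.1 hw).1).2
          have h2 := (Finset.mem_filter.1 (Finset.mem_filter.1 hw').1).2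
          exact hproper.2 w s w' h1 h2 hww
      have h2 : A.image (fun e => c e.1 e.2) ⊆ (PFcol c L0).toFinset := by
        intro γ hγ
        obtain ⟨e, he, rfl⟩ := Finset.mem_image.1 hγ
        exact List.mem_toFinset.2 (List.mem_map.2 ⟨e, PFA_sub E c L0 r j e he, rfl⟩)
      have h3 := Finset.card_sdiff_add_card_eq_card h2
      rw [Finset.card_image_of_injOn hcinj, List.toFinset_card_of_nodup hc0, PFcol_length] at h3
      omega
    have hNle : N.card ≤ (S.filter (fun e => P e s)).card + 1 := by
      obtain ⟨z, hz⟩ := PFjoin L0 hok.ne hok.nd s hs'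
      have hsub : N ⊆ insert z ((S.filter (fun e => P e s)).image Prod.fst) := by
        intro w hw
        rw [Finset.mem_insert]
        by_cases hwz : w = z
        · exact Or.inl hwz
        right
        have hwg := (Finset.mem_filter.1 hw).2
        have hwE := (Finset.mem_filter.1 (Finset.mem_filter.1 hw).1).2
        by_contra hno
        have hnt : ∀ w', (w, w') ∉ PFedges L0 := by
          intro w' hw'
          apply hno
          exact Finset.mem_image.2 ⟨(w, w'), Finset.mem_filter.2
            ⟨List.mem_toFinset.2 hw', hwE, hwg⟩, rfl⟩
        obtain ⟨L', hl', hne', hnd', hed', hhd'⟩ := hz w hwz hnt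
        have hok' : PFok E L' := by
          refine ⟨hne', hnd', fun e' he' => ?_⟩
          have := hed'.subset he'
          rcases List.mem_cons.1 this with h | h
          · rw [h]; exact hwE
          · exact hok.he _ h
        have hcol' : (PFcol c L').Perm (c w s :: PFcol c L0) :=
          hed'.map (fun e : V × V => c e.1 e.2)
        rcases hwg with hg | ⟨e', he', hce'⟩
        · have := hmax L' hok' (by omega) (hcol'.nodup_iff.2 (List.nodup_cons.2 ⟨hg, hc0⟩))
          have h3 := hcol'.length_eq
          rw [List.length_cons, PFcol_length, PFcol_length] at h3
          omega
        · refine PFchain E c L0 k r hc0 hmax j L' {s} e' hok' (by omega) (by simp; omega) ?_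
            (hce' ▸ hcol') he' ?_
          · intro h hh hhs
            exact hhd' h hh (by simpa using hhs)
          · intro e'' he''
            exact hed'.symm.subset (List.mem_cons_of_mem _ (PFA_sub E c L0 r j e'' he''))
      calc N.card ≤ _ := Finset.card_le_card hsub
        _ ≤ _ := Finset.card_insert_le _ _
        _ ≤ _ := Nat.add_le_add_right Finset.card_image_le 1
    omega
  have hsum : ∑ s ∈ T, (S.filter (fun e => P e s)).card = ∑ e ∈ S, (T.filter (fun s => P e s)).card :=
    (Finset.sum_card_bipartiteAbove_eq_sum_card_bipartiteBelow (s := S) (t := T) P).symm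
  have h1 : k * (δ + A.card) ≤ ∑ s ∈ T, ((S.filter (fun e => P e s)).card + 1 + m) := by
    rw [← hTcard, ← smul_eq_mul]
    exact Finset.card_nsmul_le_sum _ _ _ key
  have h2 : ∑ e ∈ S, (T.filter (fun s => P e s)).card ≤
      ∑ e ∈ S, ((if e ∈ A' then k else 0) + (r - 1)) := by
    apply Finset.sum_le_sum
    intro e he
    split_ifs with h
    · have := Finset.card_filter_le T (fun s => P e s)
      omega
    · have : ¬ (r ≤ (T.filter (fun s => P e s)).card) := by
        intro hr
        apply h
        rw [hA', PFA]
        exact Finset.mem_union_right _ (Finset.mem_filter.2 ⟨he, hr⟩)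
      omega
  have h3 : ∑ e ∈ S, ((if e ∈ A' then k else 0) + (r - 1)) = k * A'.card + (r - 1) * m := by
    rw [Finset.sum_add_distrib, ← Finset.sum_filter, Finset.filter_mem_eq_inter,
      Finset.inter_eq_right.2 hA'S]
    simp [hScard, mul_comm]
  rw [Finset.sum_add_distrib, Finset.sum_add_distrib, hsum] at h1
  simp only [Finset.sum_const, hTcard, smul_eq_mul, mul_one] at h1
  omega

end PF2

/-- Let `0 < ε ≤ 1` and let `G` be a properly edge-coloured digraph with minimum
in-degree `δ⁻(G) ≥ 9ε⁻³`. Then `G` contains a rainbow directed path forest with at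
most `9ε⁻²` components and at least `(1-ε)·δ⁻(G)` edges. -/
theorem stmt8 {V C : Type*} [Fintype V] [Nonempty V]
    (ε : ℝ) (hε0 : 0 < ε) (hε1 : ε ≤ 1)
    (E : V → V → Prop) (c : V → V → C)
    (hloopless : ∀ v, ¬ E v v) (hproper : ProperDiColoring E c)
    (hδ : 9 * ε⁻¹ ^ 3 ≤ ((⨅ v : V, {w | E w v}.ncard : ℕ) : ℝ)) :
    ∃ (t : ℕ) (ℓ : Fin t → ℕ) (p : ∀ j, Fin (ℓ j + 1) → V),
      IsRainbowDiPathForest E c ℓ p ∧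
      (t : ℝ) ≤ 9 * ε⁻¹ ^ 2 ∧
      (1 - ε) * ((⨅ v : V, {w | E w v}.ncard : ℕ) : ℝ) ≤ ((∑ j, ℓ j : ℕ) : ℝ) := by
  classical
  set δ : ℕ := ⨅ v : V, {w | E w v}.ncard with hδdef
  have hδv : ∀ v : V, δ ≤ {w | E w v}.ncard := fun v => ciInf_le (OrderBot.bddBelow _) v
  have hx1 : 1 ≤ ε⁻¹ := (one_le_inv₀ hε0).2 hε1
  have hxe : ε * ε⁻¹ = 1 := mul_inv_cancel₀ hε0.ne'
  set x := ε⁻¹ with hx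
  set k := ⌊9 * x ^ 2⌋₊ with hk
  have hkle : (k : ℝ) ≤ 9 * x ^ 2 := Nat.floor_le (by positivity)
  have hkge : 8 * x ^ 2 ≤ (k : ℝ) := by
    have := Nat.lt_floor_add_one (9 * x ^ 2)
    nlinarith
  have hεδ : 9 * x ^ 2 ≤ ε * δ := by
    have := mul_le_mul_of_nonneg_left hδ hε0.le
    calc 9 * x ^ 2 = ε * (9 * x ^ 3) := by linear_combination (-9 * x ^ 2) * hxe
      _ ≤ _ := this
  let Q : ℕ → Prop := fun n => ∃ L : List (List V), PFok E L ∧ L.length ≤ k ∧ (PFcol c L).Nodup ∧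
    (PFedges L).length * (k + 1) + L.length = n
  have hflat : ∀ L : List (List V), PFok E L → (PFedges L).length + L.length ≤ Fintype.card V := by
    intro L hL
    rw [PFcount L hL.ne]
    exact hL.nd.length_le_card
  have hQ0 : Q 0 := ⟨[], ⟨by simp, by simp, by simp [PFedges]⟩, by simp, by simp [PFcol, PFedges],
    by simp [PFedges]⟩
  have hQ := Nat.findGreatest_spec (P := Q) (n := Fintype.card V * (k + 1) + k) (Nat.zero_le _) hQ0
  obtain ⟨L0, hok, hlen, hc0, hval⟩ := hQ
  have hmaxQ : ∀ L, PFok E L → L.length ≤ k → (PFcol c L).Nodup →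
      (PFedges L).length * (k + 1) + L.length ≤ (PFedges L0).length * (k + 1) + L0.length := by
    intro L h1 h2 h3
    rw [hval]
    refine Nat.le_findGreatest ?_ ⟨L, h1, h2, h3, rfl⟩
    have := hflat L h1
    have : (PFedges L).length * (k + 1) ≤ Fintype.card V * (k + 1) :=
      Nat.mul_le_mul_right _ (by omega)
    omega
  have hmax : ∀ L, PFok E L → L.length ≤ k → (PFcol c L).Nodup →
      (PFedges L).length ≤ (PFedges L0).length := by
    intro L h1 h2 h3
    have := hmaxQ L h1 h2 h3
    by_contra hlt
    push Not at hlt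
    have : ((PFedges L0).length + 1) * (k + 1) ≤ (PFedges L).length * (k + 1) :=
      Nat.mul_le_mul_right _ hlt
    rw [add_mul] at this
    omega
  obtain ⟨ℓ, p, hp, hsum⟩ := PFconvert E c L0 hok.ne hok.nd hok.he hc0
  refine ⟨L0.length, ℓ, p, hp, le_trans (by exact_mod_cast hlen) hkle, ?_⟩
  rw [hsum]
  by_contra hlt
  push Not at hlt
  set m := (PFedges L0).length with hm
  have hδV : δ ≤ Fintype.card V := by
    obtain ⟨v⟩ := ‹Nonempty V›
    refine (hδv v).trans ?_
    rw [← Nat.card_eq_fintype_card]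
    exact Set.ncard_le_card _
  have hmk : m + k ≤ Fintype.card V := by
    refine le_trans ?_ hδV
    have : (m : ℝ) + k ≤ δ := by nlinarith
    exact_mod_cast this
  have hL0k : L0.length = k := by
    by_contra hne
    obtain ⟨v, hv⟩ : ∃ v, v ∉ L0.flatten := by
      by_contra hall
      push Not at hall
      have h1 : L0.flatten.toFinset = Finset.univ := by
        ext v; simp only [List.mem_toFinset, hall v, Finset.mem_univ]
      have h2 := List.toFinset_card_of_nodup hok.nd
      rw [h1, Finset.card_univ, ← PFcount L0 hok.ne] at h2
      omega
    have hed : PFedges ([v] :: L0) = PFedges L0 := by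
      rw [PFedges_cons, PFed_single, List.nil_append]
    have := hmaxQ ([v] :: L0) ⟨?_, ?_, ?_⟩ (by rw [List.length_cons]; omega) ?_
    · rw [hed, List.length_cons, ← hm] at this
      omega
    · intro l hl
      rcases List.mem_cons.1 hl with rfl | hl
      · simp
      · exact hok.ne l hl
    · rw [List.flatten_cons, List.singleton_append]
      exact List.nodup_cons.2 ⟨hv, hok.nd⟩
    · rw [hed]; exact hok.he
    · rw [PFcol, hed]; exact hc0
  set J := ⌈2 * x⌉₊ with hJ
  have hJge : 2 * x ≤ J := Nat.le_ceil _
  have hJle : (J : ℝ) ≤ 3 * x := by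
    have := Nat.ceil_lt_add_one (show 0 ≤ 2 * x by positivity)
    linarith
  have hδx : x * (ε * δ) = δ := by linear_combination (δ : ℝ) * hxe
  have hgrow : ∀ j, j ≤ J → (j : ℝ) * (ε * δ / 2) ≤ (PFA E c L0 (J + 1) j).card := by
    intro j
    induction j with
    | zero => intro _; simp
    | succ j ih =>
      intro hj
      have h1 := ih (by omega)
      have h2 := PFgrow E c hproper L0 k (J + 1) δ j hδv hok hL0k (by omega) hc0 hmax
      have h3 : (k : ℝ) * (δ + (PFA E c L0 (J + 1) j).card) ≤
          k * (PFA E c L0 (J + 1) (j+1)).card + J * m + k + k * m := by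
        exact_mod_cast h2
      generalize ((PFA E c L0 (J + 1) j).card : ℝ) = a at *
      generalize ((PFA E c L0 (J + 1) (j+1)).card : ℝ) = b at *
      have hk0 : (0 : ℝ) < k := by nlinarith
      have hεδ9 : 9 ≤ ε * δ := by nlinarith
      have hm1 : (m : ℝ) ≤ δ - ε * δ := by nlinarith
      have hmδ : (m : ℝ) ≤ x * (ε * δ) := by rw [hδx]; linarith
      have hJm : (J : ℝ) * m ≤ k * (ε * δ * (7 / 18)) := by
        calc (J : ℝ) * m ≤ (3 * x) * (x * (ε * δ)) := by gcongr
          _ ≤ (8 * x ^ 2) * (ε * δ * (7 / 18)) := by nlinarith [mul_nonneg (sq_nonneg x) (by linarith : 0 ≤ ε * δ)]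
          _ ≤ _ := by gcongr
      have h4 : (k : ℝ) * (a + ε * δ / 2) ≤ k * b := by
        have : (k : ℝ) * (ε * δ / 2 + ε * δ * (7/18)) ≤ k * (δ - m - 1) := by
          apply mul_le_mul_of_nonneg_left _ hk0.le
          linarith
        nlinarith
      have h5 := le_of_mul_le_mul_left h4 hk0
      push_cast
      linarith
  have h1 := hgrow J le_rfl
  have h2 : (PFA E c L0 (J + 1) J).card ≤ m := by
    refine le_trans (Finset.card_le_card (t := (PFedges L0).toFinset) ?_) (List.toFinset_card_le _)
    intro e he
    exact List.mem_toFinset.2 (PFA_sub E c L0 _ _ e he)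
  have h2' : ((PFA E c L0 (J + 1) J).card : ℝ) ≤ m := by exact_mod_cast h2
  have hpos : 0 < ε * δ := by nlinarith
  have h3 : (2 * x) * (ε * δ / 2) ≤ J * (ε * δ / 2) := by gcongr
  nlinarith
end

section
/- Let n be prime and let S ⊆ ℤ_n \ {0} with |S| = d ≥ 4. Then the Cayley digraph Cay(ℤ_n, S) is a robust (ν,τ)-out-expander for ν = d²/(8n²) and τ = d/(2n); that is, for every U ⊆ ℤ_n with τn ≤ |U| ≤ (1−τ)n, the set of vertices with at least νn in-neighbours in U contains at least νn vertices outside U. -/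
/-- In the Cayley digraph `Cay(ℤ_n, S)` (edge from `a` to `a + s` for `s ∈ S`), the
in-degree of `x` into a set `U`, i.e. the number of `u ∈ U` with an edge `u → x`. -/
def cayInDeg {n : ℕ} (S U : Finset (ZMod n)) (x : ZMod n) : ℕ :=
  (U.filter fun u => x - u ∈ S).card

/-- The `ν`-robust out-neighbourhood of `U` in `Cay(ℤ_n, S)`: all vertices with at
least `νn` in-neighbours in `U` (here the threshold `t = νn` is given as a real). -/
def cayRobustOutNbhd {n : ℕ} (S U : Finset (ZMod n)) (t : ℝ) : Set (ZMod n) :=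
  {x | t ≤ (cayInDeg S U x : ℝ)}

theorem cay_eq_sum {n : ℕ} [NeZero n] (A B : Finset (ZMod n)) (x : ZMod n) :
    cayInDeg A B x = ∑ b, (if x - b ∈ A then 1 else 0) * (if b ∈ B then 1 else 0) := by
  unfold cayInDeg
  rw [Finset.card_filter, ← Finset.sum_filter_add_sum_filter_not Finset.univ (· ∈ B)]
  rw [Finset.filter_mem_eq_inter, Finset.univ_inter]
  rw [Finset.sum_eq_zero (s := Finset.filter _ _)]
  · simp only [add_zero]
    exact Finset.sum_congr rfl (fun b hb => by simp [hb])
  · intro b hb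
    simp at hb
    simp [hb]

theorem cay_comm {n : ℕ} [NeZero n] (A B : Finset (ZMod n)) (x : ZMod n) :
    cayInDeg A B x = cayInDeg B A x := by
  rw [cay_eq_sum, cay_eq_sum]
  refine Fintype.sum_equiv (Equiv.subLeft x) _ _ (fun b => ?_)
  simp [mul_comm]

theorem cay_dyson {n : ℕ} [NeZero n] (A B : Finset (ZMod n)) (x : ZMod n) :
    cayInDeg A B x = cayInDeg (A ∪ B) (A ∩ B) x + cayInDeg (A \ B) (B \ A) x := by
  have h1 : cayInDeg A B x = cayInDeg A (A ∩ B) x + cayInDeg (A ∩ B) (B \ A) x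
      + cayInDeg (A \ B) (B \ A) x := by
    simp only [cay_eq_sum, ← Finset.sum_add_distrib]
    refine Finset.sum_congr rfl (fun b _ => ?_)
    by_cases h1 : x - b ∈ A <;> by_cases h2 : x - b ∈ B <;> by_cases h3 : b ∈ A <;>
      by_cases h4 : b ∈ B <;> simp [h1, h2, h3, h4]
  have h2 : cayInDeg (A ∪ B) (A ∩ B) x = cayInDeg A (A ∩ B) x + cayInDeg (B \ A) (A ∩ B) x := by
    simp only [cay_eq_sum, ← Finset.sum_add_distrib]
    refine Finset.sum_congr rfl (fun b _ => ?_)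
    by_cases h1 : x - b ∈ A <;> by_cases h2 : x - b ∈ B <;> by_cases h3 : b ∈ A <;>
      by_cases h4 : b ∈ B <;> simp [h1, h2, h3, h4]
  rw [h1, h2, cay_comm (B \ A)]

theorem cay_sum {n : ℕ} [NeZero n] (A B : Finset (ZMod n)) :
    ∑ x, cayInDeg A B x = A.card * B.card := by
  simp only [cay_eq_sum]
  rw [Finset.sum_comm]
  have : ∀ b : ZMod n, ∑ x : ZMod n, (if x - b ∈ A then 1 else 0) * (if b ∈ B then 1 else 0)
      = A.card * (if b ∈ B then 1 else 0) := by
    intro b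
    rw [← Finset.sum_mul]
    congr 1
    rw [Fintype.sum_equiv (Equiv.subRight b) _ (fun y => if y ∈ A then 1 else 0) (fun x => by simp)]
    simp
  simp only [this]
  rw [← Finset.mul_sum]
  simp

theorem cay_le {n : ℕ} (A B : Finset (ZMod n)) (x : ZMod n) :
    cayInDeg A B x ≤ B.card := Finset.card_filter_le _ _

/-- translation -/
theorem cay_translate {n : ℕ} [NeZero n] (A B : Finset (ZMod n)) (c x : ZMod n) :
    cayInDeg A (B.map (Equiv.addRight c).toEmbedding) (x + c) = cayInDeg A B x := by
  rw [cay_eq_sum, cay_eq_sum]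
  symm
  refine Fintype.sum_equiv (Equiv.addRight c) _ _ (fun b => ?_)
  simp

theorem exists_translate {n : ℕ} [Fact n.Prime] (A B : Finset (ZMod n)) (hA : A.Nonempty)
    (hA' : A.card < n) (hB : 2 ≤ B.card) :
    ∃ c : ZMod n, (A ∩ (B.map (Equiv.addRight c).toEmbedding)).Nonempty ∧
      ¬ (B.map (Equiv.addRight c).toEmbedding) ⊆ A := by
  by_contra! hcon
  obtain ⟨b, hb, b', hb', hne⟩ := Finset.one_lt_card.mp (show 1 < B.card by omega)
  have key : ∀ a ∈ A, a + (b' - b) ∈ A := by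
    intro a ha
    have := hcon (a - b) ⟨a, by
      simp only [Finset.mem_inter, Finset.mem_map]
      exact ⟨ha, b, hb, by simp⟩⟩
    apply this
    simp only [Finset.mem_map]
    exact ⟨b', hb', by simp; ring⟩
  obtain ⟨a, ha⟩ := hA
  have key2 : ∀ k : ℕ, a + k * (b' - b) ∈ A := by
    intro k
    induction k with
    | zero => simpa
    | succ k ih =>
      have := key _ ih
      convert this using 1
      push_cast; ring
  have hne' : b' - b ≠ 0 := sub_ne_zero.mpr hne.symm
  have : A = Finset.univ := by
    ext y
    simp only [Finset.mem_univ, iff_true]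
    have := key2 ((y - a) / (b' - b)).val
    rw [ZMod.natCast_zmod_val, div_mul_cancel₀ _ hne'] at this
    simpa using this
  rw [this, Finset.card_univ, ZMod.card] at hA'
  omega

theorem pollard {n : ℕ} [Fact n.Prime] : ∀ (m : ℕ) (A B : Finset (ZMod n)) (t : ℕ),
    B.card = m → t ≤ A.card → t ≤ B.card → A.card + B.card ≤ n + t →
    t * (A.card + B.card) ≤ ∑ x, min t (cayInDeg A B x) + t * t := by
  intro m
  induction m using Nat.strong_induction_on with
  | _ m ih =>
  intro A B t hm htA htB hn
  rcases Nat.eq_zero_or_pos t with rfl | ht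
  · simp
  rcases htB.eq_or_lt with heq | hlt
  · have : ∀ x, min t (cayInDeg A B x) = cayInDeg A B x := fun x =>
      min_eq_right (heq ▸ cay_le A B x)
    simp only [this, cay_sum]
    rw [← heq]; apply le_of_eq; ring
  obtain ⟨c, hc1, hc2⟩ := exists_translate A B (Finset.card_pos.mp (by omega)) (by omega) (by omega)
  have hsum : ∑ x, min t (cayInDeg A B x)
      = ∑ x, min t (cayInDeg A (B.map (Equiv.addRight c).toEmbedding) x) :=
    Fintype.sum_equiv (Equiv.addRight c) _ _ (fun x => by
      rw [Equiv.coe_addRight, cay_translate])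
  rw [hsum]
  have hcard : (B.map (Equiv.addRight c).toEmbedding).card = B.card := Finset.card_map _
  rw [← hcard] at hm hlt hn ⊢
  clear hsum hcard htB
  generalize B.map (Equiv.addRight c).toEmbedding = B at *
  have e1 := Finset.card_union_add_card_inter A B
  have e2 := Finset.card_sdiff_add_card_inter A B
  have e3 := Finset.card_sdiff_add_card_inter B A
  rw [Finset.inter_comm B A] at e3
  have hIpos := Finset.card_pos.mpr hc1
  have hlt' : 0 < (B \ A).card := Finset.card_pos.mpr (Finset.sdiff_nonempty.mpr hc2)
  rcases le_or_gt t (A ∩ B).card with h | h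
  · have := ih (A ∩ B).card (by omega) (A ∪ B) (A ∩ B) t rfl (by omega) h (by omega)
    rw [e1] at this
    refine this.trans ?_
    gcongr with x
    rw [cay_dyson A B]
    omega
  · obtain ⟨t', rfl⟩ := Nat.exists_eq_add_of_lt h
    have := ih (B \ A).card (by omega) (A \ B) (B \ A) (t' + 1) rfl (by omega) (by omega) (by omega)
    have h2 : ∑ x, cayInDeg (A ∪ B) (A ∩ B) x + ∑ x, min (t' + 1) (cayInDeg (A \ B) (B \ A) x)
       ≤ ∑ x, min ((A ∩ B).card + t' + 1) (cayInDeg A B x) := by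
      rw [← Finset.sum_add_distrib]
      gcongr with x
      rw [cay_dyson A B]
      have := cay_le (A ∪ B) (A ∩ B) x
      omega
    rw [cay_sum] at h2
    generalize ∑ x, min ((A ∩ B).card + t' + 1) (cayInDeg A B x) = X at *
    generalize ∑ x, min (t' + 1) (cayInDeg (A \ B) (B \ A) x) = Y at *
    rw [← e2, ← e3]
    have e4 : (A ∪ B).card = (A \ B).card + (B \ A).card + (A ∩ B).card := by omega
    rw [e4] at h2
    nlinarith

theorem stmt9 (n : ℕ) (hn : n.Prime) (S : Finset (ZMod n))
    (hS0 : (0 : ZMod n) ∉ S) (d : ℕ) (hd : S.card = d) (hd4 : 4 ≤ d)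
    (U : Finset (ZMod n))
    (hU1 : (d : ℝ) / (2 * n) * n ≤ (U.card : ℝ))
    (hU2 : (U.card : ℝ) ≤ (1 - (d : ℝ) / (2 * n)) * n) :
    (d : ℝ) ^ 2 / (8 * (n : ℝ) ^ 2) * n ≤
      ((cayRobustOutNbhd S U ((d : ℝ) ^ 2 / (8 * (n : ℝ) ^ 2) * n) \ ↑U).ncard : ℝ) := by
  classical
  haveI : Fact n.Prime := ⟨hn⟩
  have hn0 : (0 : ℝ) < n := by exact_mod_cast hn.pos
  have hdn : d ≤ n := by
    have := Finset.card_le_univ S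
    rwa [ZMod.card, hd] at this
  have hdnR : (d : ℝ) ≤ n := by exact_mod_cast hdn
  have h1 : d ≤ 2 * U.card := by
    have : (d : ℝ) / (2 * n) * n = d / 2 := by field_simp
    rw [this] at hU1
    have : (d : ℝ) ≤ 2 * U.card := by linarith
    exact_mod_cast this
  have h2 : 2 * U.card + d ≤ 2 * n := by
    have : (1 - (d : ℝ) / (2 * n)) * n = n - d / 2 := by field_simp
    rw [this] at hU2
    have : 2 * (U.card : ℝ) + d ≤ 2 * n := by linarith
    exact_mod_cast this
  have hθ : (d : ℝ) ^ 2 / (8 * (n : ℝ) ^ 2) * n = d ^ 2 / (8 * n) := by field_simp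
  rw [hθ]
  set θ : ℝ := (d : ℝ) ^ 2 / (8 * n) with hθd
  have hθ0 : 0 ≤ θ := by positivity
  have hθn : θ * n = d ^ 2 / 8 := by rw [hθd]; field_simp
  have hθd8 : θ ≤ d / 8 := by
    rw [hθd, div_le_div_iff₀ (by positivity) (by norm_num)]
    nlinarith [mul_le_mul_of_nonneg_left hdnR (Nat.cast_nonneg (α := ℝ) d)]
  obtain ⟨t, ht1, ht2⟩ : ∃ t, 2 * t ≤ d ∧ d ≤ 2 * t + 1 := ⟨d / 2, by omega, by omega⟩
  have hP := pollard U.card S U t rfl (by omega) (by omega) (by omega)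
  set R : Finset (ZMod n) := Finset.univ.filter (fun x => θ ≤ (cayInDeg S U x : ℝ)) with hR
  have hset : (cayRobustOutNbhd S U θ \ ↑U) = ((R \ U : Finset (ZMod n)) : Set (ZMod n)) := by
    ext x
    simp [cayRobustOutNbhd, hR]
  rw [hset, Set.ncard_coe_finset]
  have hRU : (R.card : ℝ) ≤ (R \ U).card + U.card := by
    have := Finset.card_le_card_sdiff_add_card (s := R) (t := U)
    exact_mod_cast this
  have hub : ((∑ x, min t (cayInDeg S U x) : ℕ) : ℝ) ≤ t * R.card + θ * n := by
    have hp : ∀ x, ((min t (cayInDeg S U x) : ℕ) : ℝ) ≤ (if x ∈ R then (t : ℝ) else 0) + θ := by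
      intro x
      by_cases hx : x ∈ R
      · have : ((min t (cayInDeg S U x) : ℕ) : ℝ) ≤ t := by exact_mod_cast min_le_left _ _
        simp only [hx, if_true]; linarith
      · have h3 : ((min t (cayInDeg S U x) : ℕ) : ℝ) ≤ cayInDeg S U x := by
          exact_mod_cast min_le_right _ _
        have : (cayInDeg S U x : ℝ) < θ := by simpa [hR] using hx
        simp only [hx, if_false]; linarith
    push_cast at hp ⊢
    refine (Finset.sum_le_sum (fun x _ => hp x)).trans ?_
    rw [Finset.sum_add_distrib]
    simp [ZMod.card]
    apply le_of_eq; ring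
  have hPR : (t : ℝ) * (d + U.card) ≤ ((∑ x, min t (cayInDeg S U x) : ℕ) : ℝ) + t * t := by
    rw [hd] at hP
    exact_mod_cast hP
  have ht1R : 2 * (t : ℝ) ≤ d := by exact_mod_cast ht1
  have ht2R : (d : ℝ) ≤ 2 * t + 1 := by exact_mod_cast ht2
  have hd4R : (4 : ℝ) ≤ d := by exact_mod_cast hd4
  have htpos : (0 : ℝ) < t := by linarith
  rw [hθn] at hub
  have hfin : (t : ℝ) * θ ≤ t * (R \ U).card := by
    have a1 : (t : ℝ) * θ ≤ t * (d / 8) := by gcongr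
    have a2 : (t : ℝ) * R.card ≤ t * ((R \ U).card + U.card) := by gcongr
    have a3 : (t : ℝ) * t ≤ t * (d / 2) := by gcongr; linarith
    have a4 : (d : ℝ) * (d - 1) / 2 ≤ t * d := by nlinarith
    nlinarith
  exact le_of_mul_le_mul_left hfin htpos
end
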